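/- arXiv:1605.03074 — 3 statements merged into one kernel-verified Lean document; each statement's English description precedes it below -/
import Mathlib

section
/- Let λ ∈ {1,2} and m ∈ {2,3}. Then every natural number n can be written as n = x^2 + y^2 + z^2 + w^2 with x, y, z, w integers such that x + y + 3z = λ·r^m for some nonnegative integer r. -/
/-- The set of integers that are sums of three integer squares. -/
def IsSumThreeSq (n : ℤ) : Prop := ∃ p q r : ℤ, n = p ^ 2 + q ^ 2 + r ^ 2

theorem IsSumThreeSq.mul_sq {n : ℤ} (h : IsSumThreeSq n) (k : ℤ) : IsSumThreeSq (k ^ 2 * n) := by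
  obtain ⟨p, q, r, rfl⟩ := h
  exact ⟨k * p, k * q, k * r, by ring⟩

theorem exists_two_mul_abs_mul_add_le (a d : ℤ) (ha : 0 < a) :
    ∃ t : ℤ, 2 * |a * t + d| ≤ a := by
  have hdiv := Int.emod_add_mul_ediv (2 * d + a) (2 * a)
  have hnonneg := Int.emod_nonneg (2 * d + a) (b := 2 * a) (by omega)
  have hlt := Int.emod_lt_of_pos (2 * d + a) (b := 2 * a) (by omega)
  refine ⟨-((2 * d + a) / (2 * a)), ?_⟩
  have h : |2 * (a * -((2 * d + a) / (2 * a)) + d)| ≤ a := by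
    rw [abs_le]
    constructor <;> linarith
  rwa [abs_mul, abs_two] at h

/-- A reduced positive definite ternary form of determinant one has leading coefficient and leading
minor equal to one. -/
theorem eq_one_of_reduced {a k : ℤ} (ha : 0 < a) (hk : 0 < k)
    (hak : 3 * a ^ 2 ≤ 4 * k) (hka : 3 * k ^ 2 ≤ 4 * a) : a = 1 ∧ k = 1 := by
  have ha2 : a < 2 := by nlinarith
  have hk2 : k < 2 := by nlinarith
  omega

/-- A positive definite integral ternary quadratic form of determinant one only takes values that
are sums of three squares. -/
theorem isSumThreeSq_of_det_eq_one (A K : ℕ) : ∀ a b c d e f : ℤ, a.toNat = A →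
    (a * b - d ^ 2).toNat = K → 0 < a → 0 < a * b - d ^ 2 →
    a * b * c + 2 * d * e * f - a * f ^ 2 - b * e ^ 2 - c * d ^ 2 = 1 → ∀ x y z : ℤ,
    IsSumThreeSq (a * x ^ 2 + b * y ^ 2 + c * z ^ 2 + 2 * d * x * y + 2 * e * x * z
      + 2 * f * y * z) := by
  induction A using Nat.strong_induction_on generalizing K with
  | _ A ihA =>
  induction K using Nat.strong_induction_on with
  | _ K ihK =>
  intro a b c d e f hA hK ha hk hdet x y z
  obtain ⟨t, ht⟩ := exists_two_mul_abs_mul_add_le a d ha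
  obtain ⟨u, hu⟩ := exists_two_mul_abs_mul_add_le (a * b - d ^ 2) (a * f - d * e) hk
  have ht2 : 4 * (a * t + d) ^ 2 ≤ a ^ 2 := by
    have := abs_nonneg (a * t + d)
    nlinarith [sq_abs (a * t + d)]
  have hu2 : 4 * ((a * b - d ^ 2) * u + (a * f - d * e)) ^ 2 ≤ (a * b - d ^ 2) ^ 2 := by
    have := abs_nonneg ((a * b - d ^ 2) * u + (a * f - d * e))
    nlinarith [sq_abs ((a * b - d ^ 2) * u + (a * f - d * e))]
  by_cases hsmall : a * t ^ 2 + 2 * d * t + b < a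
  · have hpos : 0 < a * t ^ 2 + 2 * d * t + b := by
      refine pos_of_mul_pos_right (a := a) ?_ ha.le
      nlinarith [sq_nonneg (a * t + d)]
    have hk' : (a * t ^ 2 + 2 * d * t + b) * a - (a * t + d) ^ 2 = a * b - d ^ 2 := by ring
    have := ihA _ (by omega) _ (a * t ^ 2 + 2 * d * t + b) a c (a * t + d) (e * t + f) e rfl rfl
      hpos (by rw [hk']; exact hk) (by linear_combination hdet) y (x - t * y) z
    convert this using 1
    ring
  · have hdet' : (a * b - d ^ 2) * ((a * b - d ^ 2) * u ^ 2 + 2 * (a * f - d * e) * u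
        + (a * c - e ^ 2)) = ((a * b - d ^ 2) * u + (a * f - d * e)) ^ 2 + a := by
      linear_combination a * hdet
    by_cases hsmall' : (a * b - d ^ 2) * u ^ 2 + 2 * (a * f - d * e) * u + (a * c - e ^ 2)
        < a * b - d ^ 2
    · have hpos : 0 < (a * b - d ^ 2) * u ^ 2 + 2 * (a * f - d * e) * u + (a * c - e ^ 2) := by
        refine pos_of_mul_pos_right (a := a * b - d ^ 2) ?_ hk.le
        rw [hdet']
        positivity
      have hk' : a * (b * u ^ 2 + 2 * f * u + c) - (d * u + e) ^ 2
          = (a * b - d ^ 2) * u ^ 2 + 2 * (a * f - d * e) * u + (a * c - e ^ 2) := by ring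
      have := ihK _ (by omega) a (b * u ^ 2 + 2 * f * u + c) b (d * u + e) d (b * u + f) hA rfl ha
        (by rw [hk']; exact hpos) (by linear_combination hdet) x z (y - u * z)
      convert this using 1
      ring
    · obtain ⟨ha1, hk1⟩ := eq_one_of_reduced ha hk (by nlinarith) (by nlinarith)
      subst ha1
      refine ⟨x + d * y + e * z, y + (f - d * e) * z, z, ?_⟩
      obtain rfl : b = 1 + d ^ 2 := by linarith
      linear_combination z ^ 2 * hdet

theorem isSumThreeSq_of_dvd {n d t : ℤ} (hd : 0 < d) (hn : 0 < d * n - 1)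
    (h : d * n - 1 ∣ t ^ 2 + d) : IsSumThreeSq n := by
  obtain ⟨a, ha⟩ := h
  have hpos : 0 < a := by
    refine pos_of_mul_pos_right (a := d * n - 1) ?_ hn.le
    rw [← ha]
    positivity
  have hk : a * (d * n - 1) - t ^ 2 = d := by linarith
  have := isSumThreeSq_of_det_eq_one _ _ a (d * n - 1) n t 1 0 rfl rfl hpos (by rw [hk]; exact hd)
    (by linear_combination -n * ha) 0 0 1
  simpa using this

theorem exists_dvd_sq_add_of_jacobiSym {p d : ℕ} [Fact p.Prime] (h : jacobiSym (-d) p = 1) :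
    ∃ t : ℤ, (p : ℤ) ∣ t ^ 2 + d := by
  obtain ⟨r, hr⟩ := ZMod.isSquare_of_jacobiSym_eq_one h
  obtain ⟨t, rfl⟩ := ZMod.intCast_surjective r
  refine ⟨t, (ZMod.intCast_zmod_eq_zero_iff_dvd _ p).1 ?_⟩
  push_cast at hr ⊢
  linear_combination -hr

theorem exists_two_mul_dvd_sq_add {p d : ℤ} (hp : Odd p) (hd : Odd d)
    (h : ∃ t : ℤ, p ∣ t ^ 2 + d) : ∃ t : ℤ, 2 * p ∣ t ^ 2 + d := by
  have key : ∀ t : ℤ, Odd t → p ∣ t ^ 2 + d → 2 * p ∣ t ^ 2 + d := fun t ht h =>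
    (Int.isCoprime_two_left.2 hp).mul_dvd (ht.pow.add_odd hd).two_dvd h
  obtain ⟨t, ht⟩ := h
  rcases Int.even_or_odd t with he | ho
  · refine ⟨t + p, key _ (he.add_odd hp) ?_⟩
    have : (t + p) ^ 2 + d = t ^ 2 + d + p * (2 * t + p) := by ring
    rw [this]
    exact dvd_add ht (dvd_mul_right _ _)
  · exact ⟨t, key t ho ht⟩

theorem isSumThreeSq_of_mod_four_eq_two {n : ℕ} (hn : n % 4 = 2) : IsSumThreeSq n := by
  have hcop : (n - 1).Coprime (4 * n) := by
    refine Nat.Coprime.mul_right ?_ ?_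
    · rw [show 4 = 2 ^ 2 from rfl]
      exact Nat.Coprime.pow_right _ (Nat.coprime_two_right.2 (by rw [Nat.odd_iff]; omega))
    · exact (Nat.coprime_self_sub_left (by omega)).2 (Nat.coprime_one_left n)
  obtain ⟨p, hpn, hp, hmod⟩ := Nat.forall_exists_prime_gt_and_modEq n (by omega) hcop
  have := Fact.mk hp
  obtain ⟨v, hv⟩ := (Nat.modEq_iff_dvd' (by omega)).1 hmod.symm
  have hpd : p + 1 = (4 * v + 1) * n := by
    have : p = 4 * n * v + (n - 1) := by omega
    rw [this]
    zify [show 1 ≤ n by omega]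
    ring
  have hp4 : p % 4 = 1 := by
    have : (p + 1) % 4 = 2 := by rw [hpd, Nat.mul_mod, Nat.mul_add_mod, hn]
    omega
  have hpo : Odd p := by rw [Nat.odd_iff]; omega
  have hdo : Odd (4 * v + 1) := by rw [Nat.odd_iff]; omega
  have hJ : jacobiSym (-(4 * v + 1 : ℕ)) p = 1 := by
    rw [jacobiSym.neg _ hpo, ZMod.χ₄_nat_one_mod_four hp4, one_mul,
      jacobiSym.quadratic_reciprocity_one_mod_four (by omega) hpo,
      jacobiSym.mod_left' (a₂ := -1), jacobiSym.at_neg_one hdo,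
      ZMod.χ₄_nat_one_mod_four (by omega)]
    refine Int.modEq_iff_dvd.2 ⟨-n, ?_⟩
    have : (p : ℤ) + 1 = (4 * v + 1 : ℕ) * n := by exact_mod_cast hpd
    linarith
  obtain ⟨t, ht⟩ := exists_dvd_sq_add_of_jacobiSym hJ
  have hpd' : ((4 * v + 1 : ℕ) : ℤ) * n - 1 = p := by
    rw [sub_eq_iff_eq_add]
    exact_mod_cast hpd.symm
  exact isSumThreeSq_of_dvd (d := (4 * v + 1 : ℕ)) (t := t) (by positivity)
    (by rw [hpd']; exact_mod_cast hp.pos) (by rw [hpd']; exact ht)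

/-- The common part of the odd residue classes: `c` is the residue of `d` modulo `8`. -/
theorem isSumThreeSq_of_odd {n c : ℕ} (hn : n % 2 = 1) (hc : c % 2 = 1) (hcn : c * n % 4 = 3)
    (hJ : ∀ p d : ℕ, p.Prime → d % 8 = c % 8 → 2 * p + 1 = d * n → jacobiSym (-d) p = 1) :
    IsSumThreeSq n := by
  obtain ⟨a, ha⟩ : ∃ a, 2 * a + 1 = c * n := ⟨c * n / 2, by omega⟩
  have hcop : a.Coprime (4 * n) := by
    refine Nat.Coprime.mul_right ?_ ?_
    · rw [show 4 = 2 ^ 2 from rfl]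
      exact Nat.Coprime.pow_right _ (Nat.coprime_two_right.2 (by rw [Nat.odd_iff]; omega))
    · rw [← Nat.isCoprime_iff_coprime]
      refine ⟨-2, c, ?_⟩
      have : 2 * (a : ℤ) + 1 = c * n := by exact_mod_cast ha
      linarith
  obtain ⟨p, hpn, hp, hmod⟩ := Nat.forall_exists_prime_gt_and_modEq (a + 2) (by omega) hcop
  have := Fact.mk hp
  obtain ⟨v, hv⟩ := (Nat.modEq_iff_dvd' (by omega)).1 hmod.symm
  have hpd : 2 * p + 1 = (8 * v + c) * n := by
    have : p = 4 * n * v + a := by omega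
    rw [this]
    linear_combination ha
  obtain ⟨t, ht⟩ := exists_two_mul_dvd_sq_add (p := p) (d := (8 * v + c : ℕ))
    (by rw [Int.odd_coe_nat]; exact hp.odd_of_ne_two (by omega))
    (by rw [Int.odd_coe_nat, Nat.odd_iff]; omega)
    (exists_dvd_sq_add_of_jacobiSym (hJ p _ hp (by omega) hpd))
  have hpd' : ((8 * v + c : ℕ) : ℤ) * n - 1 = 2 * p := by
    rw [sub_eq_iff_eq_add]
    exact_mod_cast hpd.symm
  exact isSumThreeSq_of_dvd (d := (8 * v + c : ℕ)) (t := t) (by omega)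
    (by rw [hpd']; have := hp.pos; omega) (by rw [hpd']; exact ht)

theorem jacobiSym_two_mul_eq {p d n : ℕ} (hd : Odd d) (h : 2 * p + 1 = d * n) :
    jacobiSym 2 d * jacobiSym p d = ZMod.χ₄ d := by
  rw [← jacobiSym.mul_left, ← jacobiSym.at_neg_one hd]
  refine jacobiSym.mod_left' (Int.modEq_iff_dvd.2 ⟨-n, ?_⟩)
  have : 2 * (p : ℤ) + 1 = d * n := by exact_mod_cast h
  linarith

theorem isSumThreeSq_of_mod_eight_eq_three {n : ℕ} (hn : n % 8 = 3) : IsSumThreeSq n := by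
  refine isSumThreeSq_of_odd (c := 1) (by omega) rfl (by omega) fun p d hp hd h => ?_
  have hdo : Odd d := by rw [Nat.odd_iff]; omega
  have hmod : (2 * p + 1) % 8 = 3 := by rw [h, Nat.mul_mod, hd, hn]
  have hpo : Odd p := by rw [Nat.odd_iff]; omega
  have key := jacobiSym_two_mul_eq hdo h
  rw [jacobiSym.at_two hdo, ZMod.χ₈_nat_mod_eight, hd, ZMod.χ₄_nat_one_mod_four (by omega)] at key
  rw [jacobiSym.neg _ hpo, ZMod.χ₄_nat_one_mod_four (by omega), one_mul,
    jacobiSym.quadratic_reciprocity_one_mod_four (by omega) hpo]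
  simpa using key

theorem isSumThreeSq_of_mod_four_eq_one {n : ℕ} (hn : n % 4 = 1) : IsSumThreeSq n := by
  refine isSumThreeSq_of_odd (c := 3) (by omega) rfl (by omega) fun p d hp hd h => ?_
  have hdo : Odd d := by rw [Nat.odd_iff]; omega
  have key := jacobiSym_two_mul_eq hdo h
  have h8 : ZMod.χ₈ ((3 % 8 : ℕ) : ZMod 8) = -1 := by decide
  rw [jacobiSym.at_two hdo, ZMod.χ₈_nat_mod_eight, hd, h8,
    ZMod.χ₄_nat_three_mod_four (by omega)] at key
  have hmod : (2 * p + 1) % 8 = 3 * (n % 8) % 8 := by rw [h, Nat.mul_mod, hd]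
  have hpo : Odd p := by rw [Nat.odd_iff]; omega
  rw [jacobiSym.neg _ hpo]
  rcases (by omega : p % 4 = 1 ∨ p % 4 = 3) with hp4 | hp4
  · rw [ZMod.χ₄_nat_one_mod_four hp4, jacobiSym.quadratic_reciprocity_one_mod_four' hdo hp4]
    linarith
  · rw [ZMod.χ₄_nat_three_mod_four hp4,
      jacobiSym.quadratic_reciprocity_three_mod_four (by omega) hp4]
    linarith

theorem isSumThreeSq_of_mod_eight {n : ℤ} (hn : 0 ≤ n)
    (h : n % 8 = 1 ∨ n % 8 = 2 ∨ n % 8 = 3 ∨ n % 8 = 5 ∨ n % 8 = 6) : IsSumThreeSq n := by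
  lift n to ℕ using hn
  rcases (by omega : n % 8 = 3 ∨ n % 4 = 1 ∨ n % 4 = 2) with h | h | h
  · exact isSumThreeSq_of_mod_eight_eq_three h
  · exact isSumThreeSq_of_mod_four_eq_one h
  · exact isSumThreeSq_of_mod_four_eq_two h

theorem zmod_eleven_sum_four_sq : ∀ s a b c : ZMod 11, s ^ 2 + a ^ 2 + b ^ 2 + c ^ 2 = 0 →
    (b ^ 2 = 5 * (s + a) ^ 2 ∧ c ^ 2 = 5 * (s - a) ^ 2) ∨
    (c ^ 2 = 5 * (s + a) ^ 2 ∧ b ^ 2 = 5 * (s - a) ^ 2) ∨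
    (a ^ 2 = 5 * (s + b) ^ 2 ∧ c ^ 2 = 5 * (s - b) ^ 2) ∨
    (c ^ 2 = 5 * (s + b) ^ 2 ∧ a ^ 2 = 5 * (s - b) ^ 2) ∨
    (b ^ 2 = 5 * (s + c) ^ 2 ∧ a ^ 2 = 5 * (s - c) ^ 2) ∨
    (a ^ 2 = 5 * (s + c) ^ 2 ∧ b ^ 2 = 5 * (s - c) ^ 2) := by
  decide +kernel

theorem exists_sq_eq_and_dvd {b s : ℤ} (h : (b : ZMod 11) ^ 2 = 5 * (s : ZMod 11) ^ 2) :
    ∃ b' : ℤ, b' ^ 2 = b ^ 2 ∧ 11 ∣ b' - 7 * s := by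
  have key : ((b - 7 * s : ℤ) : ZMod 11) * ((-b - 7 * s : ℤ) : ZMod 11) = 0 := by
    push_cast
    have h44 : (44 : ZMod 11) = 0 := by decide
    linear_combination -h + (s : ZMod 11) ^ 2 * h44
  have : Fact (Nat.Prime 11) := ⟨by norm_num⟩
  rcases mul_eq_zero.1 key with h | h
  · exact ⟨b, rfl, (ZMod.intCast_zmod_eq_zero_iff_dvd _ 11).1 h⟩
  · exact ⟨-b, neg_sq b, (ZMod.intCast_zmod_eq_zero_iff_dvd _ 11).1 h⟩

theorem exists_sum_four_sq_of_zmod {n s a b c : ℤ}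
    (h : 11 * n - s ^ 2 = a ^ 2 + b ^ 2 + c ^ 2)
    (hb : (b : ZMod 11) ^ 2 = 5 * ((s : ZMod 11) + a) ^ 2)
    (hc : (c : ZMod 11) ^ 2 = 5 * ((s : ZMod 11) - a) ^ 2) :
    ∃ x y z w : ℤ, n = x ^ 2 + y ^ 2 + z ^ 2 + w ^ 2 ∧ x + y + 3 * z = s := by
  obtain ⟨b', hb', β, hβ⟩ := exists_sq_eq_and_dvd (b := b) (s := s + a) (by push_cast; exact hb)
  obtain ⟨c', hc', γ, hγ⟩ := exists_sq_eq_and_dvd (b := c) (s := s - a) (by push_cast; exact hc)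
  rw [← hb', ← hc'] at h
  obtain rfl : b' = 11 * β + 7 * (s + a) := by linarith
  obtain rfl : c' = 11 * γ + 7 * (s - a) := by linarith
  refine ⟨2 * (s + a) + 3 * β, 2 * (s - a) + 3 * γ, -s - β - γ, -a - β + γ, ?_, by ring⟩
  linarith

/-- If `11 n - s ^ 2` is a sum of three squares, then `n` has a representation as a sum of four
squares with `x + y + 3 z = s`. -/
theorem exists_sum_four_sq_of_isSumThreeSq {n s : ℤ} (h : IsSumThreeSq (11 * n - s ^ 2)) :
    ∃ x y z w : ℤ, n = x ^ 2 + y ^ 2 + z ^ 2 + w ^ 2 ∧ x + y + 3 * z = s := by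
  obtain ⟨a, b, c, h⟩ := h
  have h0 : (s : ZMod 11) ^ 2 + (a : ZMod 11) ^ 2 + (b : ZMod 11) ^ 2 + (c : ZMod 11) ^ 2 = 0 := by
    have := (ZMod.intCast_zmod_eq_zero_iff_dvd (s ^ 2 + a ^ 2 + b ^ 2 + c ^ 2) 11).2
      ⟨n, by push_cast; linarith⟩
    exact_mod_cast this
  rcases zmod_eleven_sum_four_sq _ _ _ _ h0 with ⟨h1, h2⟩ | ⟨h1, h2⟩ | ⟨h1, h2⟩ | ⟨h1, h2⟩ |
    ⟨h1, h2⟩ | ⟨h1, h2⟩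
  all_goals exact exists_sum_four_sq_of_zmod (by linarith) h1 h2

theorem exists_isSumThreeSq_sub {l : ℤ} (hl : l = 1 ∨ l = 2) {m : ℕ} (hm : m = 2 ∨ m = 3)
    (N : ℕ) : ∃ r : ℕ, IsSumThreeSq (N - (l * (r : ℤ) ^ m) ^ 2) := by
  induction N using Nat.strong_induction_on with
  | _ N ih =>
  have hm0 : m ≠ 0 := by omega
  obtain rfl | hN := Nat.eq_zero_or_pos N
  · exact ⟨0, 0, 0, 0, by simp [hm0]⟩
  by_cases hdvd : 4 ^ m ∣ N
  · obtain ⟨M, rfl⟩ := hdvd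
    have hM : 0 < M := Nat.pos_of_mul_pos_left hN
    obtain ⟨r, hr⟩ := ih M (lt_mul_of_one_lt_left hM (Nat.one_lt_pow hm0 (by norm_num)))
    refine ⟨2 * r, ?_⟩
    convert hr.mul_sq (2 ^ m) using 1
    push_cast
    rw [show (4 : ℤ) = 2 ^ 2 by norm_num, ← pow_mul]
    ring
  have hzero : IsSumThreeSq N → ∃ r : ℕ, IsSumThreeSq (N - (l * (r : ℤ) ^ m) ^ 2) :=
    fun h => ⟨0, by simpa [hm0] using h⟩
  have hone : IsSumThreeSq (N - l ^ 2) → ∃ r : ℕ, IsSumThreeSq (N - (l * (r : ℤ) ^ m) ^ 2) :=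
    fun h => ⟨1, by simpa using h⟩
  by_cases h4 : 4 ∣ N
  · obtain ⟨M, rfl⟩ := h4
    push_cast at hzero hone ⊢
    by_cases h4 : 4 ∣ M
    · obtain ⟨M, rfl⟩ := h4
      obtain rfl : m = 3 := hm.resolve_left (by rintro rfl; omega)
      push_cast at hzero hone ⊢
      by_cases h7 : M % 8 = 7
      · rcases hl with rfl | rfl
        · refine ⟨2, ?_⟩
          convert (isSumThreeSq_of_mod_eight (n := M - 4) (by omega) (by omega)).mul_sq 4 using 1
          push_cast
          ring
        · apply hone
          convert (isSumThreeSq_of_mod_eight (n := 4 * M - 1) (by omega) (by omega)).mul_sq 2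
            using 1
          ring
      · apply hzero
        convert (isSumThreeSq_of_mod_eight (n := M) (by omega) (by omega)).mul_sq 4 using 1
        ring
    · by_cases h7 : M % 8 = 7
      · apply hone
        rcases hl with rfl | rfl
        · exact isSumThreeSq_of_mod_eight (by omega) (by omega)
        · convert (isSumThreeSq_of_mod_eight (n := M - 1) (by omega) (by omega)).mul_sq 2 using 1
          ring
      · apply hzero
        exact (isSumThreeSq_of_mod_eight (n := M) (by omega) (by omega)).mul_sq 2
  · by_cases h7 : N % 8 = 7
    · apply hone
      rcases hl with rfl | rfl <;> exact isSumThreeSq_of_mod_eight (by omega) (by omega)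
    · exact hzero (isSumThreeSq_of_mod_eight (by omega) (by omega))

theorem stmt_11 (l : ℤ) (hl : l = 1 ∨ l = 2) (m : ℕ) (hm : m = 2 ∨ m = 3) (n : ℕ) :
    ∃ x y z w : ℤ, (n : ℤ) = x ^ 2 + y ^ 2 + z ^ 2 + w ^ 2 ∧
      ∃ r : ℕ, x + y + 3 * z = l * (r : ℤ) ^ m := by
  obtain ⟨r, hr⟩ := exists_isSumThreeSq_sub hl hm (11 * n)
  push_cast at hr
  obtain ⟨x, y, z, w, h, hs⟩ := exists_sum_four_sq_of_isSumThreeSq hr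
  exact ⟨x, y, z, w, h, r, hs⟩
end

section
/- Every natural number n can be written as n = x^2 + y^2 + z^2 + w^2 with x, y, z, w integers such that w·(x + y + z + 2w) = 0. -/
/-- The integral ternary quadratic form with Gram matrix `!![a, f, e; f, b, d; e, d, c]`. -/
def ternaryForm (a b c d e f x y z : ℤ) : ℤ :=
  a * x ^ 2 + b * y ^ 2 + c * z ^ 2 + 2 * d * y * z + 2 * e * x * z + 2 * f * x * y

/-- Every value of the given ternary form is a sum of three squares. -/
def ValuesSumThreeSq (a b c d e f : ℤ) : Prop :=
  ∀ x y z : ℤ, ∃ u v w : ℤ, ternaryForm a b c d e f x y z = u ^ 2 + v ^ 2 + w ^ 2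

lemma Int.exists_abs_two_mul_add_mul_le (h : ℤ) {m : ℤ} (hm : 0 < m) :
    ∃ k : ℤ, -m ≤ 2 * (h + k * m) ∧ 2 * (h + k * m) ≤ m := by
  refine ⟨-((2 * h + m) / (2 * m)), ?_⟩
  have h1 := Int.emod_add_mul_ediv (2 * h + m) (2 * m)
  have h2 := Int.emod_nonneg (2 * h + m) (by omega : 2 * m ≠ 0)
  have h3 := Int.emod_lt_of_pos (2 * h + m) (by omega : 0 < 2 * m)
  constructor <;> nlinarith

lemma exists_reduced_ternaryForm (a b c d e f : ℤ) (ha : 0 < a) (hB : 0 < a * b - f ^ 2) :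
    ∃ b' c' d' e' f' : ℤ, a * b' - f' ^ 2 = a * b - f ^ 2 ∧
      a * b' * c' + 2 * d' * e' * f' - a * d' ^ 2 - b' * e' ^ 2 - c' * f' ^ 2 =
        a * b * c + 2 * d * e * f - a * d ^ 2 - b * e ^ 2 - c * f ^ 2 ∧
      (-a ≤ 2 * f' ∧ 2 * f' ≤ a) ∧ (-a ≤ 2 * e' ∧ 2 * e' ≤ a) ∧
      (-(a * b - f ^ 2) ≤ 2 * (a * d' - e' * f') ∧ 2 * (a * d' - e' * f') ≤ a * b - f ^ 2) ∧
      (ValuesSumThreeSq a b' c' d' e' f' → ValuesSumThreeSq a b c d e f) := by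
  obtain ⟨k, hk⟩ := Int.exists_abs_two_mul_add_mul_le (a * d - e * f) hB
  obtain ⟨j, hj⟩ := Int.exists_abs_two_mul_add_mul_le f ha
  obtain ⟨l, hl⟩ := Int.exists_abs_two_mul_add_mul_le (e + f * k) ha
  refine ⟨b + a * j ^ 2 + 2 * f * j,
    c + b * k ^ 2 + 2 * d * k + a * l ^ 2 + 2 * (e + f * k) * l,
    d + b * k + f * l + (e + f * k) * j + a * j * l, e + f * k + l * a, f + j * a,
    by ring, by ring, hj, hl, ?_, ?_⟩
  · convert hk using 2 <;> ring
  · intro h x y z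
    obtain ⟨u, v, w, huvw⟩ := h (x - j * (y - k * z) - l * z) (y - k * z) z
    refine ⟨u, v, w, huvw ▸ ?_⟩
    unfold ternaryForm
    ring

theorem valuesSumThreeSq_of_det_eq_one (a b c d e f : ℤ) (ha : 0 < a) (hB : 0 < a * b - f ^ 2)
    (hD : a * b * c + 2 * d * e * f - a * d ^ 2 - b * e ^ 2 - c * f ^ 2 = 1) :
    ValuesSumThreeSq a b c d e f := by
  induction hA : a.toNat using Nat.strong_induction_on generalizing a b c d e f with
  | _ A ihA =>
  induction hM : (a * b - f ^ 2).toNat using Nat.strong_induction_on generalizing b c d e f with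
  | _ M ihM =>
  obtain ⟨b', c', d', e', f', hB', hD', hf, he, hH, hred⟩ :=
    exists_reduced_ternaryForm a b c d e f ha hB
  apply hred
  rw [hD] at hD'
  rw [← hB'] at hB hH hM
  clear hred hB' hD
  have hBC : (a * b' - f' ^ 2) * (a * c' - e' ^ 2) = a + (a * d' - e' * f') ^ 2 := by
    linear_combination a * hD'
  rcases lt_or_ge (a * c' - e' ^ 2) (a * b' - f' ^ 2) with hC | hC
  · have hC0 : 0 < a * c' - e' ^ 2 := by
      by_contra! hneg
      nlinarith [sq_nonneg (a * d' - e' * f')]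
    intro x y z
    obtain ⟨u, v, w, h⟩ := ihM (a * c' - e' ^ 2).toNat (by omega) c' b' d' f' e' hC0
      (by linear_combination hD') rfl x z y
    refine ⟨u, v, w, h ▸ ?_⟩
    unfold ternaryForm
    ring
  have hB2 : 3 * (a * b' - f' ^ 2) ^ 2 ≤ 4 * a := by nlinarith
  have hb0 : 0 < b' := by
    by_contra! hneg
    nlinarith [sq_nonneg f']
  rcases lt_or_ge b' a with hb | hb
  · intro x y z
    obtain ⟨u, v, w, h⟩ := ihA b'.toNat (by omega) b' a c' e' d' f' hb0 (by linarith)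
      (by linear_combination hD') rfl y x z
    refine ⟨u, v, w, h ▸ ?_⟩
    unfold ternaryForm
    ring
  have h3 : 3 * a ^ 2 ≤ 4 * (a * b' - f' ^ 2) := by nlinarith
  have ha1 : a = 1 := by
    by_contra hne
    have ha2 : 2 ≤ a := by omega
    nlinarith [mul_le_mul h3 h3 (by positivity) (by positivity), pow_le_pow_left₀ (by norm_num) ha2 3,
      mul_le_mul_of_nonneg_left (pow_le_pow_left₀ (by norm_num) ha2 3) ha.le]
  subst ha1
  obtain rfl : f' = 0 := by omega
  obtain rfl : e' = 0 := by omega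
  obtain rfl : b' = 1 := by nlinarith
  obtain rfl : d' = 0 := by omega
  obtain rfl : c' = 1 := by linarith
  intro x y z
  exact ⟨x, y, z, by unfold ternaryForm; ring⟩

lemma sum_three_sq_of_dvd_sq_add (n d x : ℤ) (hd : 0 < d) (hq : 0 < d * n - 1)
    (h : d * n - 1 ∣ x ^ 2 + d) : ∃ u v w : ℤ, n = u ^ 2 + v ^ 2 + w ^ 2 := by
  obtain ⟨k, hk⟩ := h
  have hk0 : 0 < k := by
    by_contra! hneg
    nlinarith [sq_nonneg x]
  obtain ⟨u, v, w, h⟩ := valuesSumThreeSq_of_det_eq_one k (d * n - 1) n 0 1 x hk0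
    (by linarith) (by linear_combination (-n) * hk) 0 0 1
  exact ⟨u, v, w, by rw [← h]; unfold ternaryForm; ring⟩

lemma exists_dvd_sq_add_of_jacobiSym_neg {d p : ℕ} (hp : p.Prime)
    (h : jacobiSym (-d) p = 1) : ∃ x : ℤ, (p : ℤ) ∣ x ^ 2 + d := by
  have : Fact p.Prime := ⟨hp⟩
  obtain ⟨y, hy⟩ := ZMod.isSquare_of_jacobiSym_eq_one h
  obtain ⟨x, rfl⟩ := ZMod.intCast_surjective y
  refine ⟨x, (ZMod.intCast_zmod_eq_zero_iff_dvd _ p).mp ?_⟩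
  push_cast at hy ⊢
  linear_combination -hy

lemma sum_three_sq_of_mod_four_eq_two {n : ℕ} (hn : n % 4 = 2) :
    ∃ u v w : ℤ, (n : ℤ) = u ^ 2 + v ^ 2 + w ^ 2 := by
  have hcop : (n - 1).Coprime (4 * n) := by
    have h1 : (n - 1).Coprime n := by
      simpa [Nat.sub_add_cancel (by omega : 1 ≤ n)] using
        Nat.coprime_self_add_right.mpr (Nat.coprime_one_right (n - 1))
    have h2 : (n - 1).Coprime 2 := (Nat.odd_iff.mpr (by omega)).coprime_two_right
    exact Nat.Coprime.mul_right (h2.pow_right 2) h1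
  obtain ⟨p, hpn, hp, hmod⟩ :=
    Nat.forall_exists_prime_gt_and_modEq n (by omega : 4 * n ≠ 0) hcop
  obtain ⟨v, hv⟩ := (Nat.modEq_iff_dvd' (by omega)).mp hmod.symm
  have hpd : p + 1 = (4 * v + 1) * n := by
    have : p = 4 * n * v + (n - 1) := by omega
    rw [this, add_assoc, Nat.sub_add_cancel (by omega)]
    ring
  have hp4 : p % 4 = 1 := by
    have : p + 1 = 4 * (v * n) + n := by rw [hpd]; ring
    omega
  have hpdZ : (p : ℤ) + 1 = (4 * v + 1) * n := by exact_mod_cast hpd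
  have hodd : Odd (4 * v + 1) := by rw [Nat.odd_iff]; omega
  have hJ : jacobiSym (-(4 * v + 1 : ℕ)) p = 1 := by
    rw [jacobiSym.neg _ (Nat.odd_iff.mpr (by omega)), ZMod.χ₄_nat_one_mod_four hp4, one_mul,
      jacobiSym.quadratic_reciprocity_one_mod_four (by omega) (Nat.odd_iff.mpr (by omega)),
      jacobiSym.mod_left' (a₂ := -1), jacobiSym.at_neg_one hodd,
      ZMod.χ₄_nat_one_mod_four (by omega)]
    apply Int.ModEq.symm
    rw [Int.modEq_iff_dvd]
    exact ⟨n, by push_cast; linear_combination hpdZ⟩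
  obtain ⟨x, hx⟩ := exists_dvd_sq_add_of_jacobiSym_neg hp hJ
  have hq : ((4 * v + 1 : ℕ) : ℤ) * n - 1 = p := by push_cast; linear_combination -hpdZ
  exact sum_three_sq_of_dvd_sq_add n (4 * v + 1 : ℕ) x (by positivity)
    (by rw [hq]; exact_mod_cast hp.pos) (hq ▸ hx)

lemma sum_three_sq_of_mod_four_eq_one {n : ℕ} (hn : n % 4 = 1) :
    ∃ u v w : ℤ, (n : ℤ) = u ^ 2 + v ^ 2 + w ^ 2 := by
  obtain ⟨m, hm⟩ : ∃ m, 2 * m + 1 = 3 * n := ⟨(3 * n - 1) / 2, by omega⟩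
  have hcop : m.Coprime (4 * n) := by
    have h1 : m.Coprime n := by
      refine Nat.Coprime.coprime_mul_left_right (k := 3) ?_
      rw [← hm]
      simp
    have h2 : m.Coprime 2 := (Nat.odd_iff.mpr (by omega)).coprime_two_right
    exact Nat.Coprime.mul_right (h2.pow_right 2) h1
  obtain ⟨p, hpn, hp, hmod⟩ :=
    Nat.forall_exists_prime_gt_and_modEq m (by omega : 4 * n ≠ 0) hcop
  obtain ⟨v, hv⟩ := (Nat.modEq_iff_dvd' (by omega)).mp hmod.symm
  have hpm : p = 4 * n * v + m := by omega
  have hpd : 2 * p + 1 = (8 * v + 3) * n := by rw [hpm]; linear_combination hm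
  have hp2 : p % 2 = 1 := by
    have : p = 4 * (n * v) + m := by rw [hpm]; ring
    omega
  have hpdZ : 2 * (p : ℤ) + 1 = (8 * v + 3) * n := by exact_mod_cast hpd
  have hodd : Odd (8 * v + 3) := by rw [Nat.odd_iff]; omega
  have hJ2 : jacobiSym (-2 * p) (8 * v + 3) = 1 := by
    rw [jacobiSym.mod_left' (a₂ := 1), jacobiSym.one_left]
    rw [← Int.ModEq, Int.modEq_iff_dvd]
    exact ⟨n, by push_cast; linear_combination hpdZ⟩
  have hχ : ZMod.χ₈' (8 * v + 3 : ℕ) = 1 := by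
    rw [ZMod.χ₈'_nat_eq_if_mod_eight, if_neg (by omega), if_pos (by omega)]
  have hJp : jacobiSym p (8 * v + 3) = 1 := by
    rwa [jacobiSym.mul_left, jacobiSym.at_neg_two hodd, hχ, one_mul] at hJ2
  have hJ : jacobiSym (-(8 * v + 3 : ℕ)) p = 1 := by
    rw [jacobiSym.neg _ (Nat.odd_iff.mpr hp2)]
    rcases Nat.odd_mod_four_iff.mp hp2 with hp4 | hp4
    · rw [ZMod.χ₄_nat_one_mod_four hp4, one_mul,
        jacobiSym.quadratic_reciprocity_one_mod_four' hodd hp4, hJp]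
    · rw [ZMod.χ₄_nat_three_mod_four hp4,
        jacobiSym.quadratic_reciprocity_three_mod_four (by omega) hp4, hJp]
      norm_num
  obtain ⟨x, hx⟩ : ∃ x : ℤ, (p : ℤ) ∣ x ^ 2 + (8 * v + 3 : ℕ) ∧ Odd x := by
    obtain ⟨x, hx⟩ := exists_dvd_sq_add_of_jacobiSym_neg hp hJ
    rcases Int.even_or_odd x with hxe | hxo
    · refine ⟨x + p, ?_, hxe.add_odd (by exact_mod_cast Nat.odd_iff.mpr hp2)⟩
      rw [show (x + p) ^ 2 + ((8 * v + 3 : ℕ) : ℤ) =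
        x ^ 2 + (8 * v + 3 : ℕ) + p * (2 * x + p) by ring]
      exact dvd_add hx (dvd_mul_right _ _)
    · exact ⟨x, hx, hxo⟩
  have h2 : (2 : ℤ) ∣ x ^ 2 + (8 * v + 3 : ℕ) :=
    (hx.2.pow.add_odd (by exact_mod_cast hodd)).two_dvd
  have hc : IsCoprime (2 : ℤ) p := by
    exact_mod_cast Nat.isCoprime_iff_coprime.mpr (Nat.odd_iff.mpr hp2).coprime_two_left
  have hq : ((8 * v + 3 : ℕ) : ℤ) * n - 1 = 2 * p := by push_cast; linear_combination -hpdZ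
  exact sum_three_sq_of_dvd_sq_add n (8 * v + 3 : ℕ) x (by positivity)
    (by rw [hq]; exact_mod_cast Nat.mul_pos two_pos hp.pos) (hq ▸ hc.mul_dvd h2 hx.1)

/-- Left division of the pure quaternion `a i + b j + c k` by a quaternion of norm `7`. -/
lemma exists_sum_four_sq_of_seven_mul (n a b c : ℤ) (h : 7 * n = a ^ 2 + b ^ 2 + c ^ 2)
    (hb : (7 : ℤ) ∣ b - 2 * a) (hc : (7 : ℤ) ∣ c - 3 * a) :
    ∃ x y z w : ℤ, n = x ^ 2 + y ^ 2 + z ^ 2 + w ^ 2 ∧ x + y + z + 2 * w = 0 := by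
  obtain ⟨s, hs⟩ := hb
  obtain ⟨t, ht⟩ := hc
  obtain rfl : b = 2 * a + 7 * s := by linarith
  obtain rfl : c = 3 * a + 7 * t := by linarith
  exact ⟨-(a + s + t), a + s + 2 * t, t - 2 * s, s - t, by linarith, by ring⟩

lemma ZMod.seven_isotropic : ∀ a b c : ZMod 7, a ^ 2 + b ^ 2 + c ^ 2 = 0 →
    ((b - 2 * a = 0 ∨ -b - 2 * a = 0) ∧ (c - 3 * a = 0 ∨ -c - 3 * a = 0)) ∨
    ((c - 2 * a = 0 ∨ -c - 2 * a = 0) ∧ (b - 3 * a = 0 ∨ -b - 3 * a = 0)) := by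
  decide

lemma exists_sum_four_sq_of_seven_mul_sum_three_sq (n a b c : ℤ)
    (h : 7 * n = a ^ 2 + b ^ 2 + c ^ 2) :
    ∃ x y z w : ℤ, n = x ^ 2 + y ^ 2 + z ^ 2 + w ^ 2 ∧ x + y + z + 2 * w = 0 := by
  have h7 : (a : ZMod 7) ^ 2 + (b : ZMod 7) ^ 2 + (c : ZMod 7) ^ 2 = 0 := by
    have := congrArg (Int.cast : ℤ → ZMod 7) h
    push_cast at this
    rw [← this, show (7 : ZMod 7) = 0 from rfl, zero_mul]
  have hdvd (k : ℤ) (hk : (k : ZMod 7) = 0) : (7 : ℤ) ∣ k :=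
    (ZMod.intCast_zmod_eq_zero_iff_dvd k 7).mp hk
  rcases ZMod.seven_isotropic a b c h7 with ⟨h1 | h1, h2 | h2⟩ | ⟨h1 | h1, h2 | h2⟩
  · exact exists_sum_four_sq_of_seven_mul n a b c (by linarith)
      (hdvd _ (by exact_mod_cast h1)) (hdvd _ (by exact_mod_cast h2))
  · exact exists_sum_four_sq_of_seven_mul n a b (-c) (by linarith)
      (hdvd _ (by exact_mod_cast h1)) (hdvd _ (by exact_mod_cast h2))
  · exact exists_sum_four_sq_of_seven_mul n a (-b) c (by linarith)
      (hdvd _ (by exact_mod_cast h1)) (hdvd _ (by exact_mod_cast h2))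
  · exact exists_sum_four_sq_of_seven_mul n a (-b) (-c) (by linarith)
      (hdvd _ (by exact_mod_cast h1)) (hdvd _ (by exact_mod_cast h2))
  · exact exists_sum_four_sq_of_seven_mul n a c b (by linarith)
      (hdvd _ (by exact_mod_cast h1)) (hdvd _ (by exact_mod_cast h2))
  · exact exists_sum_four_sq_of_seven_mul n a c (-b) (by linarith)
      (hdvd _ (by exact_mod_cast h1)) (hdvd _ (by exact_mod_cast h2))
  · exact exists_sum_four_sq_of_seven_mul n a (-c) b (by linarith)
      (hdvd _ (by exact_mod_cast h1)) (hdvd _ (by exact_mod_cast h2))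
  · exact exists_sum_four_sq_of_seven_mul n a (-c) (-b) (by linarith)
      (hdvd _ (by exact_mod_cast h1)) (hdvd _ (by exact_mod_cast h2))

theorem stmt_13 (n : ℕ) :
    ∃ x y z w : ℤ, (n : ℤ) = x ^ 2 + y ^ 2 + z ^ 2 + w ^ 2 ∧
      w * (x + y + z + 2 * w) = 0 := by
  induction n using Nat.strong_induction_on with
  | _ n ih =>
  rcases Nat.eq_zero_or_pos n with rfl | hn
  · exact ⟨0, 0, 0, 0, by norm_num, by norm_num⟩
  have hlt : n % 4 < 4 := Nat.mod_lt _ (by norm_num)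
  interval_cases hr : n % 4
  · obtain ⟨m, rfl⟩ := Nat.dvd_of_mod_eq_zero hr
    obtain ⟨x, y, z, w, h, h0⟩ := ih m (by omega)
    exact ⟨2 * x, 2 * y, 2 * z, 2 * w, by push_cast; rw [h]; ring, by linear_combination 4 * h0⟩
  · obtain ⟨x, y, z, h⟩ := sum_three_sq_of_mod_four_eq_one hr
    exact ⟨x, y, z, 0, by rw [h]; ring, zero_mul _⟩
  · obtain ⟨x, y, z, h⟩ := sum_three_sq_of_mod_four_eq_two hr
    exact ⟨x, y, z, 0, by rw [h]; ring, zero_mul _⟩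
  · obtain ⟨a, b, c, h⟩ := sum_three_sq_of_mod_four_eq_one (n := 7 * n) (by omega)
    obtain ⟨x, y, z, w, h1, h2⟩ :=
      exists_sum_four_sq_of_seven_mul_sum_three_sq n a b c (by exact_mod_cast h)
    exact ⟨x, y, z, w, h1, by rw [h2, mul_zero]⟩
end

section
/- Let λ ∈ {1,2} and m ∈ {2,3}. Then every natural number n can be written as n = x^2 + y^2 + z^2 + w^2 with x, y, z, w integers such that x + y + z + 2w = λ·r^m for some nonnegative integer r. -/
/-- `(s, a, b, c)` is killed modulo `7` by the transpose of the matrix with orthogonal rows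
`(1, 1, 1, 2)`, `(1, -1, 2, -1)`, `(1, -2, -1, 1)`, `(2, 1, -1, -1)`. -/
def Good7 (s a b c : ZMod 7) : Prop :=
  s + a + b + 2 * c = 0 ∧ s - a - 2 * b + c = 0 ∧ s + 2 * a - b - c = 0 ∧ 2 * s - a + b - c = 0

instance (s a b c : ZMod 7) : Decidable (Good7 s a b c) := by unfold Good7; infer_instance

set_option maxRecDepth 100000 in
theorem exists_good7 : ∀ s a b c : ZMod 7, s ^ 2 + a ^ 2 + b ^ 2 + c ^ 2 = 0 →
    ∃ e f g : ℤˣ, Good7 s (e * a) (f * b) (g * c) ∨ Good7 s (e * a) (g * c) (f * b) ∨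
      Good7 s (f * b) (e * a) (g * c) ∨ Good7 s (f * b) (g * c) (e * a) ∨
      Good7 s (g * c) (e * a) (f * b) ∨ Good7 s (g * c) (f * b) (e * a) := by
  decide +kernel

/-- A positive definite binary form of determinant `D` properly represents some positive `M` with
`3 * M ^ 2 ≤ 4 * D`. -/
theorem exists_reduced_binary (A B C : ℤ) (hA : 0 < A) (hD : 0 < A * C - B ^ 2) :
    ∃ α β γ δ : ℤ, α * δ - β * γ = 1 ∧
      0 < A * α ^ 2 + 2 * B * α * γ + C * γ ^ 2 ∧
      3 * (A * α ^ 2 + 2 * B * α * γ + C * γ ^ 2) ^ 2 ≤ 4 * (A * C - B ^ 2) := by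
  obtain ⟨k, hk⟩ : ∃ k : ℕ, A.toNat = k := ⟨_, rfl⟩
  induction k using Nat.strong_induction_on generalizing A B C with
  | _ k ih =>
    obtain ⟨t, ht⟩ : ∃ t : ℤ, (2 * (B + t * A)) ^ 2 ≤ A ^ 2 := by
      refine ⟨-((2 * B + A) / (2 * A)), sq_le_sq' ?_ ?_⟩
      all_goals
        have h1 := Int.emod_add_mul_ediv (2 * B + A) (2 * A)
        have h2 := Int.emod_nonneg (2 * B + A) (b := 2 * A) (by omega)
        have h3 := Int.emod_lt_of_pos (2 * B + A) (b := 2 * A) (by omega)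
        linarith
    set B' := B + t * A with hB'
    set C' := C + 2 * B * t + A * t ^ 2 with hC'
    have hdet : A * C' - B' ^ 2 = A * C - B ^ 2 := by rw [hB', hC']; ring
    by_cases h : A ≤ C'
    · refine ⟨1, 0, 0, 1, by ring, by linarith, ?_⟩
      nlinarith
    · push Not at h
      have hC'0 : 0 < C' := by
        by_contra hc
        nlinarith [sq_nonneg B']
      obtain ⟨α, β, γ, δ, h1, h2, h3⟩ := ih C'.toNat (by omega) C' (-B') A hC'0
        (by linarith) rfl
      have e : A * (t * α - γ) ^ 2 + 2 * B * (t * α - γ) * α + C * α ^ 2 =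
          C' * α ^ 2 + 2 * -B' * α * γ + A * γ ^ 2 := by rw [hB', hC']; ring
      refine ⟨t * α - γ, t * β - δ, α, β, by linarith, by rw [e]; exact h2, by rw [e]; linarith⟩

theorem eq_one_of_sq_le {a G : ℤ} (ha : 0 < a) (hG : 0 < G) (h : 3 * a ^ 2 ≤ 4 * G)
    (h' : 3 * G ^ 2 ≤ 4 * a) : a = 1 ∧ G = 1 := by
  have h1 : a ≤ 1 := by
    by_contra! h1
    have : G ≤ a := by nlinarith
    nlinarith
  have h2 : G ≤ 1 := by nlinarith
  omega

/-- Every value of a positive definite integral ternary form of determinant `1` is a sum of three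
squares. -/
theorem exists_sum_three_squares_of_det_eq_one (a b c p q r : ℤ) (ha : 0 < a)
    (hab : 0 < a * b - r ^ 2)
    (hdet : a * b * c + 2 * p * q * r - a * p ^ 2 - b * q ^ 2 - c * r ^ 2 = 1) (x y z : ℤ) :
    ∃ s t u : ℤ, a * x ^ 2 + b * y ^ 2 + c * z ^ 2 + 2 * p * y * z + 2 * q * x * z + 2 * r * x * y =
      s ^ 2 + t ^ 2 + u ^ 2 := by
  obtain ⟨k, hk⟩ : ∃ k : ℕ, a.toNat = k := ⟨_, rfl⟩
  induction k using Nat.strong_induction_on generalizing a b c p q r x y z with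
  | _ k ih =>
    have hD : (a * b - r ^ 2) * (a * c - q ^ 2) - (a * p - q * r) ^ 2 = a := by
      linear_combination a * hdet
    obtain ⟨α, β, γ, δ, h1, h2, h3⟩ := exists_reduced_binary (a * b - r ^ 2) (a * p - q * r)
      (a * c - q ^ 2) hab (by rw [hD]; exact ha)
    rw [hD] at h3
    set G := (a * b - r ^ 2) * α ^ 2 + 2 * (a * p - q * r) * α * γ + (a * c - q ^ 2) * γ ^ 2 with hG
    set r₁ := r * α + q * γ with hr₁
    obtain ⟨t, ht⟩ : ∃ t : ℤ, (2 * (r₁ + t * a)) ^ 2 ≤ a ^ 2 := by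
      refine ⟨-((2 * r₁ + a) / (2 * a)), sq_le_sq' ?_ ?_⟩
      all_goals
        have h1 := Int.emod_add_mul_ediv (2 * r₁ + a) (2 * a)
        have h2 := Int.emod_nonneg (2 * r₁ + a) (b := 2 * a) (by omega)
        have h3 := Int.emod_lt_of_pos (2 * r₁ + a) (b := 2 * a) (by omega)
        linarith
    set r' := r₁ + t * a with hr'
    set b' := a * t ^ 2 + b * α ^ 2 + c * γ ^ 2 + 2 * p * α * γ + 2 * q * t * γ + 2 * r * t * α
      with hb'
    have hab' : a * b' - r' ^ 2 = G := by rw [hb', hr', hr₁, hG]; ring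
    obtain ⟨Y, Z, rfl, rfl⟩ : ∃ Y Z : ℤ, y = α * Y + β * Z ∧ z = γ * Y + δ * Z :=
      ⟨δ * y - β * z, α * z - γ * y, by linear_combination -y * h1, by linear_combination -z * h1⟩
    by_cases h : a ≤ b'
    · obtain ⟨rfl, hG1⟩ : a = 1 ∧ G = 1 := by
        have h4 : a * a ≤ a * b' := mul_le_mul_of_nonneg_left h ha.le
        exact eq_one_of_sq_le ha h2 (by linarith) h3
      set B' := (1 * b - r ^ 2) * α * β + (1 * p - q * r) * (α * δ + β * γ) +
        (1 * c - q ^ 2) * γ * δ with hB'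
      set C' := (1 * b - r ^ 2) * β ^ 2 + 2 * (1 * p - q * r) * β * δ + (1 * c - q ^ 2) * δ ^ 2
        with hC'
      have hdet' : G * C' - B' ^ 2 = 1 := by
        have : G * C' - B' ^ 2 = (α * δ - β * γ) ^ 2 *
            ((1 * b - r ^ 2) * (1 * c - q ^ 2) - (1 * p - q * r) ^ 2) := by
          rw [hG, hB', hC']; ring
        rw [this, h1, hD]; norm_num
      refine ⟨x + r * (α * Y + β * Z) + q * (γ * Y + δ * Z), Y + B' * Z, Z, ?_⟩
      have e : 1 * x ^ 2 + b * (α * Y + β * Z) ^ 2 + c * (γ * Y + δ * Z) ^ 2 +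
          2 * p * (α * Y + β * Z) * (γ * Y + δ * Z) + 2 * q * x * (γ * Y + δ * Z) +
          2 * r * x * (α * Y + β * Z) = (x + r * (α * Y + β * Z) + q * (γ * Y + δ * Z)) ^ 2 +
          (G * Y ^ 2 + 2 * B' * Y * Z + C' * Z ^ 2) := by
        rw [hG, hB', hC']; ring
      rw [hG1] at hdet' e
      rw [e]
      linear_combination Z ^ 2 * hdet'
    · push Not at h
      have hb'0 : 0 < b' := by
        by_contra hc
        have := mul_nonneg ha.le (by linarith : 0 ≤ -b')
        linarith [sq_nonneg r']
      set q' := r * β + q * δ with hq'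
      set p' := b * α * β + c * γ * δ + p * (α * δ + β * γ) + q * t * δ + r * t * β with hp'
      set c' := b * β ^ 2 + c * δ ^ 2 + 2 * p * β * δ with hc'
      have hdet' : b' * a * c' + 2 * q' * p' * r' - b' * q' ^ 2 - a * p' ^ 2 - c' * r' ^ 2 = 1 := by
        have : b' * a * c' + 2 * q' * p' * r' - b' * q' ^ 2 - a * p' ^ 2 - c' * r' ^ 2 =
            (α * δ - β * γ) ^ 2 *
              (a * b * c + 2 * p * q * r - a * p ^ 2 - b * q ^ 2 - c * r ^ 2) := by
          rw [hb', hq', hp', hc', hr', hr₁]; ring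
        rw [this, h1, hdet]; norm_num
      obtain ⟨s, u, v, huv⟩ := ih b'.toNat (by omega) b' a c' q' p' r' hb'0 (by linarith) hdet'
        Y (x - t * Y) Z rfl
      refine ⟨s, u, v, ?_⟩
      rw [← huv, hb', hq', hp', hc', hr', hr₁]
      ring

/-- If `k * p + 1 = d * N`, then suitable congruence conditions make `-d` a square modulo `k * p`. -/
theorem exists_dvd_sq_add {d p N k : ℕ} (hp : p.Prime)
    (hk : k = 1 ∧ d % 4 = 1 ∧ p % 4 = 1 ∨
      k = 2 ∧ (d % 8 = 1 ∧ p % 4 = 1 ∨ d % 8 = 3 ∧ p % 2 = 1))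
    (h : k * p + 1 = d * N) : ∃ b : ℤ, (k * p : ℤ) ∣ b ^ 2 + d := by
  have := Fact.mk hp
  have hodd : p % 2 = 1 := by omega
  have hd : Odd d := Nat.odd_iff.2 (by omega)
  have hJ : jacobiSym (-d) p = 1 := by
    have e1 : jacobiSym (-d) p = jacobiSym p d := by
      rcases (by omega : p % 4 = 1 ∨ (p % 4 = 3 ∧ d % 4 = 3)) with h4 | ⟨h4, h5⟩
      · rw [jacobiSym.neg _ (Nat.odd_iff.2 hodd), ZMod.χ₄_nat_one_mod_four h4, one_mul,
          jacobiSym.quadratic_reciprocity_one_mod_four' hd h4]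
      · rw [jacobiSym.neg _ (Nat.odd_iff.2 hodd), ZMod.χ₄_nat_three_mod_four h4,
          jacobiSym.quadratic_reciprocity_three_mod_four h5 h4]
        ring
    have e2 : jacobiSym (k * p : ℤ) d = jacobiSym (-1) d := by
      apply jacobiSym.mod_left'
      apply Int.ModEq.symm
      rw [Int.modEq_iff_dvd]
      exact ⟨N, by linarith [(by exact_mod_cast h : (k * p + 1 : ℤ) = d * N)]⟩
    rw [e1]
    rcases hk with ⟨rfl, h1, -⟩ | ⟨rfl, h1⟩
    · simp only [Nat.cast_one, one_mul] at e2
      rw [e2, jacobiSym.at_neg_one hd, ZMod.χ₄_nat_one_mod_four h1]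
    · have e3 : jacobiSym (-2) d = 1 := by
        rw [jacobiSym.at_neg_two hd, ZMod.χ₈'_nat_eq_if_mod_eight]
        rw [if_neg (by omega), if_pos (by omega)]
      have e4 : jacobiSym (-2) d = jacobiSym (-1) d * jacobiSym 2 d := by
        rw [← jacobiSym.mul_left]; norm_num
      rw [jacobiSym.mul_left, Nat.cast_ofNat] at e2
      rw [e4, ← e2] at e3
      have e5 : jacobiSym 2 d * jacobiSym 2 d = 1 := by
        rw [← sq]
        exact jacobiSym.sq_one (Int.isCoprime_iff_gcd_eq_one.1
          (by simpa using (Nat.isCoprime_iff_coprime.2 (Nat.coprime_two_left.2 hd))))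
      linear_combination e3 - jacobiSym p d * e5
  obtain ⟨β, hβ⟩ := ZMod.isSquare_of_jacobiSym_eq_one hJ
  obtain ⟨b, rfl⟩ := ZMod.intCast_surjective β
  have hb : (p : ℤ) ∣ b ^ 2 + d := by
    rw [← ZMod.intCast_zmod_eq_zero_iff_dvd]
    push_cast at hβ ⊢
    linear_combination -hβ
  rcases hk with ⟨rfl, -⟩ | ⟨rfl, -⟩
  · exact ⟨b, by simpa using hb⟩
  · have hcop : IsCoprime ((2 : ℕ) : ℤ) p :=
      Nat.isCoprime_iff_coprime.2 (Nat.coprime_two_left.2 (Nat.odd_iff.2 hodd))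
    rcases Int.emod_two_eq_zero_or_one b with hb2 | hb2
    · refine ⟨b + p, hcop.mul_dvd ?_ ?_⟩
      · have : (b + p) % 2 = 1 := by omega
        obtain ⟨e, he⟩ := Int.odd_iff.2 this
        obtain ⟨f, hf⟩ := hd
        exact ⟨2 * e ^ 2 + 2 * e + f + 1, by rw [he, hf]; push_cast; ring⟩
      · obtain ⟨e, he⟩ := hb
        exact ⟨e + 2 * b + p, by linear_combination he⟩
    · refine ⟨b, hcop.mul_dvd ?_ hb⟩
      obtain ⟨e, he⟩ := Int.odd_iff.2 hb2
      obtain ⟨f, hf⟩ := hd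
      exact ⟨2 * e ^ 2 + 2 * e + f + 1, by rw [he, hf]; push_cast; ring⟩

theorem exists_sum_three_squares_of_dvd {d N c : ℕ} {b : ℤ} (hd : 0 < d) (hc : 0 < c)
    (h : c + 1 = d * N) (hb : (c : ℤ) ∣ b ^ 2 + d) :
    ∃ x y z : ℤ, (N : ℤ) = x ^ 2 + y ^ 2 + z ^ 2 := by
  obtain ⟨a, ha⟩ := hb
  have h' : (c + 1 : ℤ) = d * N := by exact_mod_cast h
  have ha0 : 0 < a := by
    refine pos_of_mul_pos_right (a := (c : ℤ)) ?_ (by positivity)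
    rw [← ha]; positivity
  obtain ⟨x, y, z, e⟩ := exists_sum_three_squares_of_det_eq_one a c N 0 1 b ha0
    (by nlinarith) (by linear_combination -N * ha - h') 0 0 1
  exact ⟨x, y, z, by rw [← e]; ring⟩

theorem exists_sum_three_squares_of_mod {N : ℕ}
    (hN : N % 4 = 2 ∨ N % 8 = 1 ∨ N % 8 = 3 ∨ N % 8 = 5) :
    ∃ x y z : ℤ, (N : ℤ) = x ^ 2 + y ^ 2 + z ^ 2 := by
  by_cases h2 : N % 4 = 2
  · have hcop : (N - 1).Coprime (4 * N) := by
      refine Nat.Coprime.mul_right ?_ ?_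
      · exact Nat.Coprime.pow_right 2 (Nat.coprime_two_right.2 (Nat.odd_iff.2 (by omega)))
      · exact (Nat.coprime_self_sub_left (by omega)).2 (Nat.coprime_one_left N)
    obtain ⟨p, hpN, hp, hmod⟩ := Nat.forall_exists_prime_gt_and_modEq N (by omega) hcop
    obtain ⟨m, hm⟩ := (Nat.modEq_iff_dvd' (by omega)).1 hmod.symm
    have e : 1 * p + 1 = (4 * m + 1) * N := by
      have : p = 4 * N * m + (N - 1) := by omega
      rw [this]
      have : N - 1 + 1 = N := by omega
      linarith
    have hp4 : p % 4 = 1 := by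
      have : p = 4 * (N * m) + (N - 1) := by rw [← mul_assoc]; omega
      omega
    obtain ⟨b, hb⟩ := exists_dvd_sq_add hp (Or.inl ⟨rfl, by omega, hp4⟩) e
    exact exists_sum_three_squares_of_dvd (by omega) (by have := hp.pos; omega) e
      (by exact_mod_cast hb)
  · obtain ⟨c, hc, hcN⟩ : ∃ c, (c = 1 ∧ N % 8 = 3 ∨ c = 3 ∧ N % 4 = 1) ∧ c * N % 4 = 3 := by
      rcases (by omega : N % 8 = 3 ∨ N % 4 = 1) with h | h
      · exact ⟨1, by omega, by omega⟩
      · exact ⟨3, by omega, by omega⟩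
    obtain ⟨u, hu⟩ : ∃ u, 2 * u + 1 = c * N := ⟨c * N / 2, by omega⟩
    have hcop : u.Coprime (4 * N) := by
      refine Nat.Coprime.mul_right ?_ ?_
      · exact Nat.Coprime.pow_right 2 (Nat.coprime_two_right.2 (Nat.odd_iff.2 (by omega)))
      · rw [Nat.coprime_iff_gcd_eq_one, ← Nat.dvd_one]
        refine (Nat.dvd_add_right (a := u.gcd N) (b := 2 * u) ((Nat.gcd_dvd_left u N).mul_left 2)).1 ?_
        rw [hu]
        exact (Nat.gcd_dvd_right u N).mul_left c
    obtain ⟨p, hpN, hp, hmod⟩ := Nat.forall_exists_prime_gt_and_modEq u (by omega) hcop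
    obtain ⟨m, hm⟩ := (Nat.modEq_iff_dvd' (by omega)).1 hmod.symm
    have hpu : p = 4 * (N * m) + u := by rw [← mul_assoc]; omega
    have e : 2 * p + 1 = (8 * m + c) * N := by rw [hpu]; linarith
    obtain ⟨b, hb⟩ := exists_dvd_sq_add hp (Or.inr ⟨rfl, by
      rcases hc with ⟨rfl, h⟩ | ⟨rfl, h⟩ <;> omega⟩) e
    exact exists_sum_three_squares_of_dvd (by omega) (by have := hp.pos; omega) e
      (by exact_mod_cast hb)

/-- **Legendre's three-square theorem.** -/
theorem exists_sum_three_squares (N : ℕ) (hN : ∀ k j : ℕ, N ≠ 4 ^ k * (8 * j + 7)) :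
    ∃ x y z : ℤ, (N : ℤ) = x ^ 2 + y ^ 2 + z ^ 2 := by
  induction N using Nat.strong_induction_on with
  | _ N ih =>
    rcases Nat.eq_zero_or_pos N with rfl | hpos
    · exact ⟨0, 0, 0, by norm_num⟩
    by_cases h4 : N % 4 = 0
    · obtain ⟨M, rfl⟩ := Nat.dvd_of_mod_eq_zero h4
      obtain ⟨x, y, z, h⟩ := ih M (by omega) fun k j hkj => hN (k + 1) j (by rw [hkj]; ring)
      exact ⟨2 * x, 2 * y, 2 * z, by push_cast; rw [h]; ring⟩
    · have := hN 0 (N / 8)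
      exact exists_sum_three_squares_of_mod (by omega)

theorem exists_sum_four_squares_of_good7 {n : ℕ} {s a b c : ℤ}
    (h : (7 * n : ℤ) = s ^ 2 + a ^ 2 + b ^ 2 + c ^ 2) (hg : Good7 s a b c) :
    ∃ x y z w : ℤ, (n : ℤ) = x ^ 2 + y ^ 2 + z ^ 2 + w ^ 2 ∧ x + y + z + 2 * w = s := by
  obtain ⟨h1, h2, h3, h4⟩ := hg
  have key (t : ℤ) (ht : (t : ZMod 7) = 0) : ∃ x, t = 7 * x :=
    (ZMod.intCast_zmod_eq_zero_iff_dvd t 7).1 ht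
  obtain ⟨x, hx⟩ := key (s + a + b + 2 * c) (by push_cast; exact h1)
  obtain ⟨y, hy⟩ := key (s - a - 2 * b + c) (by push_cast; exact h2)
  obtain ⟨z, hz⟩ := key (s + 2 * a - b - c) (by push_cast; exact h3)
  obtain ⟨w, hw⟩ := key (2 * s - a + b - c) (by push_cast; exact h4)
  obtain rfl : s = x + y + z + 2 * w := by linarith
  obtain rfl : a = x - y + 2 * z - w := by linarith
  obtain rfl : b = x - 2 * y - z + w := by linarith
  obtain rfl : c = 2 * x + y - z - w := by linarith
  exact ⟨x, y, z, w, by linarith, rfl⟩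

theorem exists_sum_four_squares_of_sum_three_squares {n : ℕ} {s a b c : ℤ}
    (h : (7 * n : ℤ) = s ^ 2 + a ^ 2 + b ^ 2 + c ^ 2) :
    ∃ x y z w : ℤ, (n : ℤ) = x ^ 2 + y ^ 2 + z ^ 2 + w ^ 2 ∧ x + y + z + 2 * w = s := by
  have h7 : (s : ZMod 7) ^ 2 + (a : ZMod 7) ^ 2 + (b : ZMod 7) ^ 2 + (c : ZMod 7) ^ 2 = 0 := by
    have := congrArg (Int.cast : ℤ → ZMod 7) h
    push_cast at this
    rw [← this, show (7 : ZMod 7) = 0 from rfl, zero_mul]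
  obtain ⟨e, f, g, hg⟩ := exists_good7 _ _ _ _ h7
  have sq (e : ℤˣ) (a : ℤ) : ((e : ℤ) * a) ^ 2 = a ^ 2 := by
    rw [mul_pow, ← Units.val_pow_eq_pow_val, Int.units_sq, Units.val_one, one_mul]
  rw [← sq e a, ← sq f b, ← sq g c] at h
  simp only [← Int.cast_mul] at hg
  rcases hg with hg | hg | hg | hg | hg | hg <;>
    exact exists_sum_four_squares_of_good7 (by linarith) hg

theorem exists_sum_four_squares_of_ne {n s N : ℕ} (h : 7 * n = s ^ 2 + N)
    (hN : ∀ k j : ℕ, N ≠ 4 ^ k * (8 * j + 7)) :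
    ∃ x y z w : ℤ, (n : ℤ) = x ^ 2 + y ^ 2 + z ^ 2 + w ^ 2 ∧ x + y + z + 2 * w = s := by
  obtain ⟨a, b, c, e⟩ := exists_sum_three_squares N hN
  refine exists_sum_four_squares_of_sum_three_squares (a := a) (b := b) (c := c) ?_
  have : (7 * n : ℤ) = s ^ 2 + N := by exact_mod_cast h
  rw [this, e]; ring

theorem four_pow_mul_ne {i u : ℕ} (hu : u % 4 ≠ 0) (hu' : u % 8 ≠ 7) (k j : ℕ) :
    4 ^ i * u ≠ 4 ^ k * (8 * j + 7) := by
  induction i generalizing k with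
  | zero =>
    rcases k with _ | k
    · omega
    · rw [pow_succ']; simp only [mul_assoc]; omega
  | succ i ih =>
    rcases k with _ | k
    · rw [pow_succ']; simp only [mul_assoc]; omega
    · intro h
      refine ih k ?_
      rw [pow_succ', pow_succ', mul_assoc, mul_assoc] at h
      omega

theorem stmt_14 (l : ℤ) (hl : l = 1 ∨ l = 2) (m : ℕ) (hm : m = 2 ∨ m = 3) (n : ℕ) :
    ∃ x y z w : ℤ, (n : ℤ) = x ^ 2 + y ^ 2 + z ^ 2 + w ^ 2 ∧
      ∃ r : ℕ, x + y + z + 2 * w = l * (r : ℤ) ^ m := by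
  by_cases hn : ∀ k j : ℕ, 7 * n ≠ 4 ^ k * (8 * j + 7)
  · obtain ⟨x, y, z, w, h, hs⟩ := exists_sum_four_squares_of_ne (s := 0) (by ring) hn
    exact ⟨x, y, z, w, h, 0, by rw [hs]; rcases hm with rfl | rfl <;> norm_num⟩
  push Not at hn
  obtain ⟨k, j, hkj⟩ := hn
  obtain ⟨i, rfl⟩ : 7 ∣ j := by
    have h7 : 7 ∣ 4 ^ k * (8 * j + 7) := ⟨n, hkj.symm⟩
    have := (Nat.Coprime.pow_right k (by norm_num : Nat.Coprime 7 4)).dvd_of_dvd_mul_left h7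
    omega
  obtain rfl : n = 4 ^ k * (8 * i + 1) := by linarith
  clear hkj
  induction k using Nat.strong_induction_on with
  | _ k ih =>
    by_cases hkm : m ≤ k
    · obtain ⟨k, rfl⟩ := Nat.exists_eq_add_of_le hkm
      obtain ⟨x, y, z, w, h, r, hr⟩ := ih k (by omega)
      refine ⟨2 ^ m * x, 2 ^ m * y, 2 ^ m * z, 2 ^ m * w, ?_, 2 * r, ?_⟩
      · push_cast at h ⊢
        rw [pow_add, mul_assoc, h, show (4 : ℤ) ^ m = (2 ^ m) ^ 2 by rw [pow_right_comm]; norm_num]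
        ring
      · push_cast
        linear_combination 2 ^ m * hr
    have finish (r e u : ℕ) (hu : u % 4 ≠ 0) (hu' : u % 8 ≠ 7)
        (h : 7 * (4 ^ k * (8 * i + 1)) = (l.toNat * r ^ m) ^ 2 + 4 ^ e * u) :
        ∃ x y z w : ℤ, ((4 ^ k * (8 * i + 1) : ℕ) : ℤ) = x ^ 2 + y ^ 2 + z ^ 2 + w ^ 2 ∧
          ∃ r : ℕ, x + y + z + 2 * w = l * (r : ℤ) ^ m := by
      obtain ⟨x, y, z, w, h, hs⟩ := exists_sum_four_squares_of_ne h (four_pow_mul_ne hu hu')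
      refine ⟨x, y, z, w, h, r, ?_⟩
      rw [hs]
      rcases hl with rfl | rfl <;> simp
    rcases hl with rfl | rfl
    · rcases (by omega : k = 0 ∨ k = 1 ∨ k = 2 ∧ m = 3) with rfl | rfl | ⟨rfl, rfl⟩
      · exact finish 1 0 (56 * i + 6) (by omega) (by omega) (by simp; ring)
      · exact finish 1 0 (224 * i + 27) (by omega) (by omega) (by simp; ring)
      · exact finish 2 2 (56 * i + 3) (by omega) (by omega) (by simp; ring)
    · rcases (by omega : k = 0 ∨ k = 1 ∨ k = 2) with rfl | rfl | rfl
      · exact finish 1 0 (56 * i + 3) (by omega) (by omega) (by simp; ring)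
      · exact finish 1 1 (56 * i + 6) (by omega) (by omega) (by simp; ring)
      · exact finish 1 1 (224 * i + 27) (by omega) (by omega) (by simp; ring)
end
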